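/- arXiv:2408.01756 — 5 statements merged into one kernel-verified Lean document; each statement's English description precedes it below -/
import Mathlib

section
/- For every Schwartz function v : ℝ^{N+1} → ℝ and every R > 0 one has ∫_{{x ∈ ℝ^N : |x| ≥ R}} v(x,0)² dx ≤ (1/R) ∬_{ℝ^{N+1}_+} (|∇v(x,y)|² + |x|² v(x,y)²) dx dy. -/
open MeasureTheory

noncomputable section

/-- `ℝ^N` as a Euclidean space. -/
abbrev RN (N : ℕ) := EuclideanSpace ℝ (Fin N)

/-- `ℝ^{N+1}`, with points written `(x, y)`, `x ∈ ℝ^N`, `y ∈ ℝ`. -/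
abbrev RN1 (N : ℕ) := RN N × ℝ

/-- The upper half-space `{(x,y) : y > 0}`. -/
def upperHalf (N : ℕ) : Set (RN1 N) := {p | 0 < p.2}

/-- The `i`-th horizontal coordinate direction in `ℝ^{N+1}`. -/
def dirX (N : ℕ) (i : Fin N) : RN1 N := (EuclideanSpace.single i 1, 0)

/-- The vertical coordinate direction in `ℝ^{N+1}`. -/
def dirY (N : ℕ) : RN1 N := (0, 1)

/-- `|∇v|²`, the squared norm of the full gradient of `v` at `p`. -/
def gradSq (N : ℕ) (v : RN1 N → ℝ) (p : RN1 N) : ℝ :=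
  (∑ i : Fin N, (fderiv ℝ v p (dirX N i)) ^ 2) + (fderiv ℝ v p (dirY N)) ^ 2

section HalfSpaceTrace

open Set

theorem SchwartzMap.integrable_sq {E : Type*} [NormedAddCommGroup E] [NormedSpace ℝ E]
    [MeasurableSpace E] [BorelSpace E] [SecondCountableTopology E] (μ : Measure E)
    [μ.HasTemperateGrowth] (f : SchwartzMap E ℝ) : Integrable (fun p => f p ^ 2) μ := by
  obtain ⟨C, -, hC⟩ := f.decay 0 0
  have h := (f.integrable (μ := μ)).bdd_mul (c := C) f.continuous.aestronglyMeasurable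
    (Filter.Eventually.of_forall fun p => by simpa using hC p)
  simpa only [sq] using h

theorem SchwartzMap.integrable_norm_sq_mul_sq {E : Type*} [NormedAddCommGroup E] [NormedSpace ℝ E]
    [MeasurableSpace E] [BorelSpace E] [SecondCountableTopology E] (μ : Measure E)
    [μ.HasTemperateGrowth] (f : SchwartzMap E ℝ) :
    Integrable (fun p => ‖p‖ ^ 2 * f p ^ 2) μ := by
  obtain ⟨C, -, hC⟩ := f.decay 0 0
  have h := (f.integrable_pow_mul μ 2).bdd_mul (c := C)
    (f.continuous.norm.aestronglyMeasurable)
    (Filter.Eventually.of_forall fun p => by simpa using hC p)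
  refine h.congr (Filter.Eventually.of_forall fun p => ?_)
  have : ‖f p‖ * ‖f p‖ = f p ^ 2 := by rw [← sq, Real.norm_eq_abs, sq_abs]
  simp only
  rw [← this]
  ring

theorem integrable_gradSq_add (N : ℕ) (v : SchwartzMap (RN1 N) ℝ) :
    Integrable fun p => gradSq N v p + ‖p.1‖ ^ 2 * (v p) ^ 2 := by
  have : (volume : Measure (RN1 N)).IsAddHaarMeasure :=
    inferInstanceAs ((volume : Measure (RN N)).prod (volume : Measure ℝ)).IsAddHaarMeasure
  have hd (m : RN1 N) : Integrable fun p => (fderiv ℝ v p m) ^ 2 :=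
    (LineDeriv.lineDerivOp m v : SchwartzMap (RN1 N) ℝ).integrable_sq volume
  refine ((integrable_finsetSum _ fun i _ => hd (dirX N i)).add (hd (dirY N))).add ?_
  refine (v.integrable_norm_sq_mul_sq volume).mono' ?_ (Filter.Eventually.of_forall fun p => ?_)
  · have := v.continuous
    exact Continuous.aestronglyMeasurable (by fun_prop)
  · rw [Real.norm_of_nonneg (by positivity)]
    gcongr
    exact norm_fst_le p

theorem gradSq_nonneg (N : ℕ) (v : RN1 N → ℝ) (p : RN1 N) : 0 ≤ gradSq N v p :=
  add_nonneg (Finset.sum_nonneg fun _ _ => sq_nonneg _) (sq_nonneg _)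

/-- If `a²w² + (w')²` is dominated by an integrable `F`, then `a w(0)² ≤ ∫ F`. -/
theorem mul_sq_le_integral_Ioi {w w' F : ℝ → ℝ} {a : ℝ} (ha : 0 < a)
    (hw : ∀ y, HasDerivAt w (w' y) y) (hw' : Continuous w') (hF : IntegrableOn F (Ioi 0))
    (hle : ∀ y, w' y ^ 2 + a ^ 2 * w y ^ 2 ≤ F y) :
    a * w 0 ^ 2 ≤ ∫ y in Ioi 0, F y := by
  have hwc : Continuous w := continuous_iff_continuousAt.2 fun y => (hw y).continuousAt
  have hder (y : ℝ) : HasDerivAt (fun y => a * w y ^ 2) (a * (2 * w y * w' y)) y := by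
    simpa using ((hw y).pow 2).const_mul a
  have hbound (y : ℝ) : |a * (2 * w y * w' y)| ≤ F y := by
    refine le_trans (abs_le.2 ⟨?_, ?_⟩) (hle y)
    · nlinarith [sq_nonneg (w' y + a * w y)]
    · nlinarith [sq_nonneg (w' y - a * w y)]
  have hint' : IntegrableOn (fun y => a * (2 * w y * w' y)) (Ioi 0) :=
    hF.mono' (Continuous.aestronglyMeasurable (by fun_prop)) (Filter.Eventually.of_forall hbound)
  have hint : IntegrableOn (fun y => a * w y ^ 2) (Ioi 0) := by
    refine (hF.const_mul a⁻¹).mono' (Continuous.aestronglyMeasurable (by fun_prop))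
      (Filter.Eventually.of_forall fun y => ?_)
    rw [Real.norm_of_nonneg (by positivity), ← div_eq_inv_mul, le_div_iff₀ ha]
    nlinarith [hle y, sq_nonneg (w' y)]
  have hlim := tendsto_zero_of_hasDerivAt_of_integrableOn_Ioi (fun y _ => hder y) hint' hint
  have hftc := integral_Ioi_of_hasDerivAt_of_tendsto' (fun y _ => hder y) hint' hlim
  have hneg : a * w 0 ^ 2 = ∫ y in Ioi 0, -(a * (2 * w y * w' y)) := by
    rw [integral_neg, hftc]
    ring
  rw [hneg]
  exact integral_mono hint'.neg hF fun y => (neg_le_abs _).trans (hbound y)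

end HalfSpaceTrace

theorem stmt0 (N : ℕ) (hN : 2 ≤ N) (v : SchwartzMap (RN1 N) ℝ) (R : ℝ) (hR : 0 < R) :
    (∫ x in {x : RN N | R ≤ ‖x‖}, (v (x, 0)) ^ 2) ≤
      (1 / R) * ∫ p in upperHalf N, (gradSq N v p + ‖p.1‖ ^ 2 * (v p) ^ 2) := by
  set F : RN1 N → ℝ := fun p => gradSq N v p + ‖p.1‖ ^ 2 * (v p) ^ 2 with hFdef
  have hF : Integrable F := integrable_gradSq_add N v
  have hF0 (p : RN1 N) : 0 ≤ F p := add_nonneg (gradSq_nonneg N v p) (by positivity)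
  set S : Set (RN N) := {x | R ≤ ‖x‖}
  have hS : MeasurableSet S := measurableSet_le measurable_const measurable_norm
  have hsub : S ×ˢ Set.Ioi (0 : ℝ) ⊆ upperHalf N := fun p hp => hp.2
  have hFS : Integrable F ((volume.restrict S).prod (volume.restrict (Set.Ioi (0 : ℝ)))) := by
    rw [Measure.prod_restrict]
    exact hF.restrict
  have key : ∀ᵐ x ∂(volume.restrict S), R * v (x, 0) ^ 2 ≤ ∫ y in Set.Ioi 0, F (x, y) := by
    filter_upwards [hFS.prod_right_ae, ae_restrict_mem hS] with x hx hxS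
    refine mul_sq_le_integral_Ioi (w := fun y => v (x, y))
      (w' := fun y => fderiv ℝ v (x, y) (dirY N)) hR (fun y => ?_) ?_ hx fun y => ?_
    · exact (v.differentiable (x, y)).hasFDerivAt.comp_hasDerivAt y
        ((hasDerivAt_const y x).prodMk (hasDerivAt_id y))
    · have := (v.smooth 1).continuous_fderiv one_ne_zero
      fun_prop
    · have hsum : 0 ≤ ∑ i : Fin N, (fderiv ℝ v (x, y) (dirX N i)) ^ 2 :=
        Finset.sum_nonneg fun _ _ => sq_nonneg _
      have hRx : R ^ 2 * v (x, y) ^ 2 ≤ ‖x‖ ^ 2 * v (x, y) ^ 2 := by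
        gcongr
        exact hxS
      simp only [hFdef, gradSq]
      linarith
  rw [one_div, ← div_eq_inv_mul, le_div_iff₀' hR, ← integral_const_mul]
  calc ∫ x in S, R * v (x, 0) ^ 2
      ≤ ∫ x in S, ∫ y in Set.Ioi 0, F (x, y) :=
        integral_mono_of_nonneg (Filter.Eventually.of_forall fun x => by positivity)
          hFS.integral_prod_left key
    _ = ∫ p in S ×ˢ Set.Ioi (0 : ℝ), F p := (setIntegral_prod F hF.integrableOn).symm
    _ ≤ ∫ p in upperHalf N, F p :=
        setIntegral_mono_set hF.integrableOn (Filter.Eventually.of_forall hF0) hsub.eventuallyLE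
end
end

section
/- Let (v_n) be a sequence of Schwartz functions v_n : ℝ^{N+1} → ℝ for which there is a constant C with ∬_{ℝ^{N+1}_+} (|∇v_n|² + |x|² v_n²) dx dy ≤ C for all n, and suppose that for every R > 0, ∫_{{|x| < R}} v_n(x,0)² dx → 0 as n → ∞. Then ∫_{ℝ^N} v_n(x,0)² dx → 0 as n → ∞. -/
open MeasureTheory

noncomputable section

open Filter Set Topology

theorem hasTemperateGrowth_volume_RN1 (N : ℕ) :
    (volume : Measure (RN1 N)).HasTemperateGrowth := by
  have : (volume : Measure (RN1 N)).IsAddHaarMeasure :=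
    inferInstanceAs ((volume : Measure (RN N)).prod (volume : Measure ℝ)).IsAddHaarMeasure
  infer_instance

attribute [instance] hasTemperateGrowth_volume_RN1

/-- The weighted square of a Schwartz function, `‖x‖² v²`, is integrable. -/
theorem integrable_norm_fst_sq_mul_sq {N : ℕ} (v : SchwartzMap (RN1 N) ℝ) :
    Integrable (fun p : RN1 N => ‖p.1‖ ^ 2 * (v p) ^ 2) := by
  obtain ⟨M, hM⟩ := v.decay 0 0
  have hM' : ∀ p, ‖v p‖ ≤ M := fun p => by simpa using hM.2 p
  have h := (v.integrable_pow_mul volume 2).mul_bdd (c := M) v.continuous.aestronglyMeasurable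
    (ae_of_all _ hM')
  refine h.mono (by fun_prop) (ae_of_all _ fun p => ?_)
  simp only [norm_mul, norm_pow, norm_norm, sq (‖v p‖), ← mul_assoc]
  gcongr
  exact norm_fst_le p

theorem integrable_fderiv_apply_sq {N : ℕ} (v : SchwartzMap (RN1 N) ℝ) (m : RN1 N) :
    Integrable (fun p : RN1 N => (fderiv ℝ v p m) ^ 2) := by
  have h := ((LineDeriv.lineDerivOp m v).memLp 2 volume).integrable_sq
  simpa only [SchwartzMap.lineDerivOp_apply_eq_fderiv] using h

theorem integrable_gradSq {N : ℕ} (v : SchwartzMap (RN1 N) ℝ) : Integrable (gradSq N v) :=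
  (integrable_finsetSum _ fun i _ => integrable_fderiv_apply_sq v (dirX N i)).add
    (integrable_fderiv_apply_sq v (dirY N))

theorem tendsto_vertical_atTop {N : ℕ} (v : SchwartzMap (RN1 N) ℝ) (x : RN N) :
    Tendsto (fun y : ℝ => v (x, y)) atTop (𝓝 0) := by
  refine (SchwartzMap.tendsto_cocompact v).comp ?_
  rw [← Metric.cobounded_eq_cocompact, ← tendsto_norm_atTop_iff_cobounded]
  exact tendsto_atTop_mono (fun y => (le_abs_self y).trans (norm_snd_le (x, y))) tendsto_id

/-- Pointwise weighted trace inequality on almost every vertical half-line. -/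
theorem ae_norm_mul_trace_sq_le {N : ℕ} (v : SchwartzMap (RN1 N) ℝ) :
    ∀ᵐ x : RN N, ‖x‖ * (v (x, 0)) ^ 2 ≤
      ∫ y in Ioi (0 : ℝ), (gradSq N v (x, y) + ‖x‖ ^ 2 * (v (x, y)) ^ 2) := by
  have hE := (integrable_gradSq v).add (integrable_norm_fst_sq_mul_sq v)
  have hD := (((LineDeriv.lineDerivOp (dirY N) v).memLp 2 volume).integrable_mul
    (v.memLp 2 volume)).const_mul 2
  rw [Measure.volume_eq_prod] at hE hD
  filter_upwards [hE.prod_right_ae, hD.prod_right_ae] with x hEx hDx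
  simp only [Pi.mul_apply, SchwartzMap.lineDerivOp_apply_eq_fderiv] at hDx
  have hderiv : ∀ y ∈ Ici (0 : ℝ), HasDerivAt (fun y => (v (x, y)) ^ 2)
      (2 * (fderiv ℝ v (x, y) (dirY N) * v (x, y))) y := by
    intro y _
    have h1 : HasDerivAt (fun y : ℝ => (x, y)) (dirY N) y :=
      (hasDerivAt_const y x).prodMk (hasDerivAt_id y)
    have h2 := (v.differentiableAt (x := (x, y))).hasFDerivAt.comp_hasDerivAt y h1
    refine (h2.pow 2).congr_deriv ?_
    simp only [Function.comp_apply, Nat.cast_ofNat]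
    ring
  have hftc := integral_Ioi_of_hasDerivAt_of_tendsto' hderiv hDx.integrableOn
    (m := 0) (by simpa using (tendsto_vertical_atTop v x).pow 2)
  have hkey : ‖x‖ * (v (x, 0)) ^ 2 = ∫ y in Ioi (0 : ℝ),
      -‖x‖ * (2 * (fderiv ℝ v (x, y) (dirY N) * v (x, y))) := by
    rw [integral_const_mul, hftc]; ring
  rw [hkey]
  refine integral_mono (hDx.integrableOn.const_mul _) hEx.integrableOn fun y => ?_
  have hs : 0 ≤ ∑ i : Fin N, (fderiv ℝ v (x, y) (dirX N i)) ^ 2 :=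
    Finset.sum_nonneg fun i _ => sq_nonneg _
  simp only [gradSq]
  nlinarith [sq_nonneg (fderiv ℝ v (x, y) (dirY N) + ‖x‖ * v (x, y))]

theorem integrable_integral_vertical_energy {N : ℕ} (v : SchwartzMap (RN1 N) ℝ) :
    Integrable fun x : RN N =>
      ∫ y in Ioi (0 : ℝ), (gradSq N v (x, y) + ‖x‖ ^ 2 * (v (x, y)) ^ 2) := by
  have hE := (integrable_gradSq v).add (integrable_norm_fst_sq_mul_sq v)
  have hE' := hE.integrableOn (s := univ ×ˢ Ioi (0 : ℝ))
  rw [IntegrableOn, Measure.volume_eq_prod, ← Measure.prod_restrict, Measure.restrict_univ] at hE'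
  exact hE'.integral_prod_left

theorem integral_upperHalf_energy {N : ℕ} (v : SchwartzMap (RN1 N) ℝ) :
    ∫ p in upperHalf N, (gradSq N v p + ‖p.1‖ ^ 2 * (v p) ^ 2) =
      ∫ x : RN N, ∫ y in Ioi (0 : ℝ), (gradSq N v (x, y) + ‖x‖ ^ 2 * (v (x, y)) ^ 2) := by
  have hE := (integrable_gradSq v).add (integrable_norm_fst_sq_mul_sq v)
  have hset : upperHalf N = univ ×ˢ Ioi (0 : ℝ) := by ext p; simp [upperHalf]
  have h := setIntegral_prod (μ := (volume : Measure (RN N))) (ν := (volume : Measure ℝ))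
    (fun p : RN1 N => gradSq N v p + ‖p.1‖ ^ 2 * (v p) ^ 2) (hE.integrableOn (s := univ ×ˢ Ioi 0))
  rwa [← hset, Measure.restrict_univ, ← Measure.volume_eq_prod] at h

/-- Outside the ball of radius `R`, the mass of the trace is at most the energy divided by `R`. -/
theorem integral_trace_sq_le {N : ℕ} (v : SchwartzMap (RN1 N) ℝ) {R : ℝ} (hR : 0 < R) :
    ∫ x : RN N, (v (x, 0)) ^ 2 ≤ (∫ x in {x : RN N | ‖x‖ < R}, (v (x, 0)) ^ 2) +
      (∫ p in upperHalf N, (gradSq N v p + ‖p.1‖ ^ 2 * (v p) ^ 2)) / R := by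
  have hG := integrable_integral_vertical_energy v
  have hle := ae_norm_mul_trace_sq_le v
  rw [integral_upperHalf_energy]
  set G : RN N → ℝ := fun x =>
    ∫ y in Ioi (0 : ℝ), (gradSq N v (x, y) + ‖x‖ ^ 2 * (v (x, y)) ^ 2)
  have hcont : Continuous fun x : RN N => (v (x, 0)) ^ 2 := by fun_prop
  have hGR : Integrable fun x => G x / R := hG.div_const R
  have hGnonneg : 0 ≤ᵐ[volume] fun x => G x / R := by
    filter_upwards [hle] with x hx
    exact div_nonneg (le_trans (by positivity) hx) hR.le
  have hmeas : MeasurableSet {x : RN N | ‖x‖ < R} := measurableSet_lt measurable_norm measurable_const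
  have hout : ∀ᵐ x ∂(volume.restrict {x : RN N | ‖x‖ < R}ᶜ), (v (x, 0)) ^ 2 ≤ G x / R := by
    filter_upwards [ae_restrict_of_ae hle, ae_restrict_mem hmeas.compl] with x hx hxR
    rw [le_div_iff₀ hR, mul_comm]
    refine le_trans ?_ hx
    gcongr
    simpa using hxR
  have hint_in : IntegrableOn (fun x : RN N => (v (x, 0)) ^ 2) {x : RN N | ‖x‖ < R} :=
    (hcont.continuousOn.integrableOn_compact (isCompact_closedBall 0 R)).mono_set
      fun x hx => by simpa using (mem_ofPred.mp hx).le
  have hint_out : IntegrableOn (fun x : RN N => (v (x, 0)) ^ 2) {x : RN N | ‖x‖ < R}ᶜ := by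
    refine hGR.integrableOn.mono' hcont.aestronglyMeasurable ?_
    filter_upwards [hout] with x hx
    rwa [Real.norm_of_nonneg (sq_nonneg _)]
  have hint : Integrable fun x : RN N => (v (x, 0)) ^ 2 := by
    simpa [← integrableOn_univ] using hint_in.union hint_out
  rw [← integral_add_compl hmeas hint, ← integral_div]
  gcongr
  exact (integral_mono_ae hint_out hGR.integrableOn hout).trans (setIntegral_le_integral hGR hGnonneg)

open Filter in
theorem stmt2 (N : ℕ) (hN : 2 ≤ N) (v : ℕ → SchwartzMap (RN1 N) ℝ) (C : ℝ)
    (hbound : ∀ n : ℕ,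
      (∫ p in upperHalf N, (gradSq N (v n) p + ‖p.1‖ ^ 2 * (v n p) ^ 2)) ≤ C)
    (hloc : ∀ R : ℝ, 0 < R →
      Tendsto (fun n => ∫ x in {x : RN N | ‖x‖ < R}, (v n (x, 0)) ^ 2) atTop (nhds 0)) :
    Tendsto (fun n => ∫ x : RN N, (v n (x, 0)) ^ 2) atTop (nhds 0) := by
  refine tendsto_order.2 ⟨fun a ha => Eventually.of_forall fun n =>
    ha.trans_le (integral_nonneg fun x => sq_nonneg _), fun ε hε => ?_⟩
  have hC : Tendsto (fun R : ℝ => C / R) atTop (𝓝 0) := tendsto_const_nhds.div_atTop tendsto_id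
  obtain ⟨R, hRC, hR⟩ :=
    ((hC.eventually_lt_const (half_pos hε)).and (eventually_gt_atTop 0)).exists
  filter_upwards [(hloc R hR).eventually_lt_const (half_pos hε)] with n hn
  have h1 := integral_trace_sq_le (v n) hR
  have h2 := div_le_div_of_nonneg_right (hbound n) hR.le
  linarith
end
end

section
/- Let G : ℝ^N → ℝ be a C¹ function such that G is Lebesgue integrable on ℝ^N and the function x ↦ x · ∇G(x) (the Euclidean inner product of x with the gradient of G) is Lebesgue integrable on ℝ^N. Then ∫_{ℝ^N} x · ∇G(x) dx = −N ∫_{ℝ^N} G(x) dx. -/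
open MeasureTheory

noncomputable section

section Dilation

variable {E : Type*} [NormedAddCommGroup E] [NormedSpace ℝ E]

lemma continuous_fderiv_apply_self {G : E → ℝ} (hG : ContDiff ℝ 1 G) :
    Continuous fun x => fderiv ℝ G x x :=
  (hG.continuous_fderiv one_ne_zero).clm_apply continuous_id

/-- The fundamental theorem of calculus along the dilation flow `s ↦ exp s • x`. -/
lemma intervalIntegral_fderiv_exp_smul {G : E → ℝ} (hG : ContDiff ℝ 1 G) (x : E) :
    ∫ s in (0 : ℝ)..1, fderiv ℝ G (Real.exp s • x) (Real.exp s • x) =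
      G (Real.exp 1 • x) - G x := by
  have hderiv (s : ℝ) : HasDerivAt (fun s => G (Real.exp s • x))
      (fderiv ℝ G (Real.exp s • x) (Real.exp s • x)) s :=
    ((hG.differentiable one_ne_zero _).hasFDerivAt).comp_hasDerivAt s
      ((Real.hasDerivAt_exp s).smul_const x)
  have hcont : Continuous fun s : ℝ => fderiv ℝ G (Real.exp s • x) (Real.exp s • x) :=
    (continuous_fderiv_apply_self hG).comp (Real.continuous_exp.smul continuous_const)
  rw [intervalIntegral.integral_eq_sub_of_hasDerivAt (fun s _ => hderiv s)
    (hcont.intervalIntegrable 0 1)]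
  simp

variable [MeasurableSpace E] [BorelSpace E] [FiniteDimensional ℝ E]
  (μ : Measure E) [μ.IsAddHaarMeasure]

lemma integral_comp_exp_smul (f : E → ℝ) (s : ℝ) :
    ∫ x, f (Real.exp s • x) ∂μ = Real.exp (-(Module.finrank ℝ E * s)) * ∫ x, f x ∂μ := by
  rw [Measure.integral_comp_smul, ← Real.exp_nat_mul, ← Real.exp_neg, Real.abs_exp, smul_eq_mul]

lemma integrable_prod_comp_exp_smul {f : E → ℝ} (hf : Continuous f) (hint : Integrable f μ) :
    Integrable (fun p : ℝ × E => f (Real.exp p.1 • p.2))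
      ((volume.restrict (Set.Ioc (0 : ℝ) 1)).prod μ) := by
  have hcont : Continuous fun p : ℝ × E => f (Real.exp p.1 • p.2) := by fun_prop
  rw [integrable_prod_iff hcont.aestronglyMeasurable]
  refine ⟨.of_forall fun s => hint.comp_smul (Real.exp_ne_zero s), ?_⟩
  simp_rw [integral_comp_exp_smul μ (fun x => ‖f x‖)]
  have : Continuous fun s : ℝ =>
      Real.exp (-(Module.finrank ℝ E * s)) * ∫ x, ‖f x‖ ∂μ := by fun_prop
  exact (this.integrableOn_Icc (a := 0) (b := 1)).mono_set Set.Ioc_subset_Icc_self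

lemma intervalIntegral_exp_neg_mul {c : ℝ} (hc : c ≠ 0) :
    ∫ s in (0 : ℝ)..1, Real.exp (-(c * s)) = (1 - Real.exp (-c)) / c := by
  have hderiv (s : ℝ) :
      HasDerivAt (fun s => -Real.exp (-(c * s)) / c) (Real.exp (-(c * s))) s := by
    have h := ((((hasDerivAt_id s).const_mul c).neg.exp).neg).div_const c
    refine h.congr_deriv ?_
    rw [div_eq_iff hc]
    simp
  rw [intervalIntegral.integral_eq_sub_of_hasDerivAt (fun s _ => hderiv s)
    (Continuous.intervalIntegrable (by fun_prop) 0 1)]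
  simp
  ring

theorem integral_fderiv_apply_self [Nontrivial E] {G : E → ℝ} (hG : ContDiff ℝ 1 G)
    (hint : Integrable G μ) (hint' : Integrable (fun x => fderiv ℝ G x x) μ) :
    ∫ x, fderiv ℝ G x x ∂μ = -(Module.finrank ℝ E : ℝ) * ∫ x, G x ∂μ := by
  have hn : 0 < (Module.finrank ℝ E : ℝ) := by exact_mod_cast Module.finrank_pos
  set n : ℝ := (Module.finrank ℝ E : ℝ) with hn_def
  have hswap := integral_integral_swap
    (f := fun (s : ℝ) (x : E) => fderiv ℝ G (Real.exp s • x) (Real.exp s • x))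
    (integrable_prod_comp_exp_smul μ (continuous_fderiv_apply_self hG) hint')
  simp_rw [integral_comp_exp_smul μ (fun x => fderiv ℝ G x x),
    ← intervalIntegral.integral_of_le (zero_le_one' ℝ),
    intervalIntegral_fderiv_exp_smul hG] at hswap
  rw [integral_sub (hint.comp_smul (Real.exp_ne_zero 1)) hint, integral_comp_exp_smul,
    intervalIntegral.integral_mul_const, ← hn_def, intervalIntegral_exp_neg_mul hn.ne',
    mul_one] at hswap
  have hlt : 0 < 1 - Real.exp (-n) := by
    rw [sub_pos, Real.exp_lt_one_iff]
    exact neg_neg_of_pos hn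
  apply mul_left_cancel₀ hlt.ne'
  field_simp at hswap
  linear_combination hswap

end Dilation

lemma sum_mul_fderiv_single {N : ℕ} (G : RN N → ℝ) (x : RN N) :
    ∑ i : Fin N, x i * fderiv ℝ G x (EuclideanSpace.single i 1) = fderiv ℝ G x x := by
  have h := congrArg (fderiv ℝ G x) ((EuclideanSpace.basisFun (Fin N) ℝ).sum_repr x)
  simpa only [map_sum, map_smul, smul_eq_mul, EuclideanSpace.basisFun_repr,
    EuclideanSpace.basisFun_apply] using h

theorem stmt5 (N : ℕ) (hN : 1 ≤ N) (G : RN N → ℝ) (hG : ContDiff ℝ 1 G)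
    (hint : Integrable G volume)
    (hint' : Integrable
      (fun x : RN N => ∑ i : Fin N, x i * fderiv ℝ G x (EuclideanSpace.single i 1)) volume) :
    (∫ x : RN N, ∑ i : Fin N, x i * fderiv ℝ G x (EuclideanSpace.single i 1)) =
      -(N : ℝ) * ∫ x : RN N, G x := by
  have : Nontrivial (RN N) := Module.nontrivial_of_finrank_pos (R := ℝ) (by simpa using Nat.pos_of_ne_zero (Nat.one_le_iff_ne_zero.mp hN))
  simp_rw [sum_mul_fderiv_single] at hint' ⊢
  simpa using integral_fderiv_apply_self volume hG hint hint'
end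
end

section
/- Let f : ℝ^N × ℝ → ℝ be continuous and satisfy the growth bound |f(x,t)| ≤ a|t| + b|t|^{θ−1} for all (x,t), for some constants a, b > 0 and 2 < θ < 2*. Let v : ℝ^{N+1} → ℝ be a Schwartz function such that −Δv(x,y) + |x|² v(x,y) = 0 for all (x,y) with y > 0 and −∂v/∂y(x,0) = f(x, v(x,0)) for all x ∈ ℝ^N. Then ((N−1)/2) ∬_{ℝ^{N+1}_+} |∇v|² dx dy + ((N+3)/2) ∬_{ℝ^{N+1}_+} |x|² v² dx dy = −∫_{ℝ^N} Σ_{i=1}^N x_i (∂v/∂x_i)(x,0) f(x, v(x,0)) dx. -/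
open MeasureTheory

noncomputable section

/-- The Laplacian of `v` at `p` (sum of pure second derivatives). -/
def lap (N : ℕ) (v : RN1 N → ℝ) (p : RN1 N) : ℝ :=
  (∑ i : Fin N, fderiv ℝ (fun q => fderiv ℝ v q (dirX N i)) p (dirX N i)) +
    fderiv ℝ (fun q => fderiv ℝ v q (dirY N)) p (dirY N)

/-- The critical exponent `2* = 2N/(N-1)`. -/
def twoStar (N : ℕ) : ℝ := 2 * N / (N - 1)

open scoped SchwartzMap LineDeriv

/-- The coordinate directions of `ℝ^{N+1}`, with `none` standing for the vertical one. -/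
def coordDir (N : ℕ) : Option (Fin N) → RN1 N
  | none => dirY N
  | some i => dirX N i

/-- The coordinate functions of `ℝ^{N+1}`, with `none` standing for the vertical one. -/
def coord (N : ℕ) : Option (Fin N) → RN1 N →L[ℝ] ℝ
  | none => ContinuousLinearMap.snd ℝ (RN N) ℝ
  | some i => (EuclideanSpace.proj i).comp (ContinuousLinearMap.fst ℝ (RN N) ℝ)

lemma coord_coordDir (N : ℕ) (k l : Option (Fin N)) :
    coord N l (coordDir N k) = if l = k then 1 else 0 := by
  cases k <;> cases l <;> simp [coord, coordDir, dirX, dirY, eq_comm]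

instance (N : ℕ) : (volume : Measure (RN1 N)).IsAddHaarMeasure :=
  inferInstanceAs ((volume : Measure (RN N)).prod (volume : Measure ℝ)).IsAddHaarMeasure

lemma measurableSet_upperHalf (N : ℕ) : MeasurableSet (upperHalf N) :=
  measurableSet_lt measurable_const measurable_snd

lemma upperHalf_eq_prod (N : ℕ) : upperHalf N = Set.univ ×ˢ Set.Ioi (0 : ℝ) := by
  ext p; simp [upperHalf]

/-- Horizontal derivatives of Schwartz functions have zero integral over the half-space. -/
lemma setIntegral_fderiv_dirX (N : ℕ) (G : 𝓢(RN1 N, ℝ)) (i : Fin N) :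
    ∫ p in upperHalf N, fderiv ℝ G p (dirX N i) = 0 := by
  have hm := measurableSet_upperHalf N
  have hmul (g : RN1 N → ℝ) : (fun p => (upperHalf N).indicator (fun _ => (1 : ℝ)) p * g p) =
      (upperHalf N).indicator g := by
    funext p
    by_cases hp : p ∈ upperHalf N <;> simp [hp]
  have hG : Integrable G := G.integrable
  have hG' : Integrable (fun p => fderiv ℝ G p (dirX N i)) := by
    simpa only [← SchwartzMap.lineDerivOp_apply_eq_fderiv] using
      (∂_{dirX N i} G : 𝓢(RN1 N, ℝ)).integrable (μ := volume)
  have key := integral_bilinear_hasLineDerivAt_right_eq_neg_left_of_integrable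
    (μ := (volume : Measure (RN1 N))) (v := dirX N i) (B := ContinuousLinearMap.mul ℝ ℝ)
    (f := (upperHalf N).indicator fun _ => (1 : ℝ)) (f' := fun _ => 0)
    (g := G) (g' := fun p => fderiv ℝ G p (dirX N i))
    (by simp)
    (by simpa [hmul] using hG'.indicator hm)
    (by simpa [hmul] using hG.indicator hm)
    (fun p _ => by
      have : (fun t : ℝ => (upperHalf N).indicator (fun _ => (1 : ℝ)) (p + t • dirX N i)) =
          fun _ => (upperHalf N).indicator (fun _ => (1 : ℝ)) p := by
        funext t
        have : p + t • dirX N i ∈ upperHalf N ↔ p ∈ upperHalf N := by simp [upperHalf, dirX]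
        by_cases hp : p ∈ upperHalf N <;> simp [this, hp]
      rw [HasLineDerivAt, this]
      exact hasDerivAt_const _ _)
    (fun p _ => (G.hasFDerivAt p).hasLineDerivAt _)
  rw [← integral_indicator hm]
  simpa [hmul] using key

/-- The vertical derivative of a Schwartz function integrates over the half-space to minus the
integral of the trace. -/
lemma setIntegral_fderiv_dirY (N : ℕ) (G : 𝓢(RN1 N, ℝ)) :
    ∫ p in upperHalf N, fderiv ℝ G p (dirY N) = -∫ x : RN N, G (x, 0) := by
  have hG' : Integrable (fun p => fderiv ℝ G p (dirY N)) := by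
    simpa only [← SchwartzMap.lineDerivOp_apply_eq_fderiv] using
      (∂_{dirY N} G : 𝓢(RN1 N, ℝ)).integrable (μ := volume)
  have hres : (volume : Measure (RN1 N)).restrict (upperHalf N) =
      (volume : Measure (RN N)).prod (volume.restrict (Set.Ioi (0 : ℝ))) := by
    rw [upperHalf_eq_prod, Measure.volume_eq_prod, ← Measure.prod_restrict, Measure.restrict_univ]
  have hint : Integrable (fun p => fderiv ℝ G p (dirY N))
      ((volume : Measure (RN N)).prod (volume.restrict (Set.Ioi (0 : ℝ)))) := by
    rw [← hres]; exact hG'.integrableOn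
  rw [hres, integral_prod _ hint, ← integral_neg]
  refine integral_congr_ae ?_
  filter_upwards [hint.prod_right_ae] with x hx
  have hderiv (y : ℝ) : HasDerivAt (fun y => G (x, y)) (fderiv ℝ G (x, y) (dirY N)) y :=
    (G.hasFDerivAt (x, y)).comp_hasDerivAt y ((hasDerivAt_const y x).prodMk (hasDerivAt_id y))
  have hlim : Filter.Tendsto (fun y : ℝ => G (x, y)) Filter.atTop (nhds 0) := by
    refine G.tendsto_cocompact.comp ?_
    rw [← Metric.cobounded_eq_cocompact, ← comap_norm_atTop, Filter.tendsto_comap_iff]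
    refine Filter.tendsto_atTop_mono (fun y => ?_) Filter.tendsto_id
    exact (le_abs_self y).trans (norm_snd_le (x, y))
  simpa using integral_Ioi_of_hasDerivAt_of_tendsto' (fun y _ => hderiv y) hx hlim

/-- The Pohozaev flux associated with the dilation field, for `-Δv + |x|² v = 0`. -/
def pohozaevFlux (N : ℕ) (v : 𝓢(RN1 N, ℝ)) (k : Option (Fin N)) (p : RN1 N) : ℝ :=
  fderiv ℝ v p (coordDir N k) * ∑ l, coord N l p * fderiv ℝ v p (coordDir N l) -
    coord N k p / 2 * (∑ l, fderiv ℝ v p (coordDir N l) ^ 2 + ‖p.1‖ ^ 2 * v p ^ 2)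

lemma hasTemperateGrowth_norm_fst_sq (N : ℕ) :
    Function.HasTemperateGrowth (fun p : RN1 N => ‖p.1‖ ^ 2) :=
  (Function.hasTemperateGrowth_norm_sq (RN N)).comp
    (ContinuousLinearMap.fst ℝ (RN N) ℝ).hasTemperateGrowth

lemma exists_schwartz_pohozaevFlux (N : ℕ) (v : 𝓢(RN1 N, ℝ)) (k : Option (Fin N)) :
    ∃ F : 𝓢(RN1 N, ℝ), ⇑F = pohozaevFlux N v k := by
  let D (l : Option (Fin N)) : 𝓢(RN1 N, ℝ) := ∂_{coordDir N l} v
  have hc (l) : Function.HasTemperateGrowth (coord N l) := (coord N l).hasTemperateGrowth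
  have hD (l) : Function.HasTemperateGrowth (D l) := (D l).hasTemperateGrowth
  have hv := v.hasTemperateGrowth
  have hw := hasTemperateGrowth_norm_fst_sq N
  have h1 : Function.HasTemperateGrowth (fun p => ∑ l, coord N l p * D l p) :=
    Function.HasTemperateGrowth.sum fun l _ => (hc l).mul (hD l)
  have hck : Function.HasTemperateGrowth (fun p => coord N k p / 2) := by
    exact (hc k).mul (.const (2⁻¹ : ℝ))
  have h2 (l) : Function.HasTemperateGrowth (fun p => coord N k p / 2 * D l p) := hck.mul (hD l)
  have h3 : Function.HasTemperateGrowth (fun p => coord N k p / 2 * (‖p.1‖ ^ 2 * v p)) :=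
    hck.mul (hw.mul hv)
  refine ⟨SchwartzMap.smulLeftCLM ℝ (fun p => ∑ l, coord N l p * D l p) (D k) -
    ((∑ l, SchwartzMap.smulLeftCLM ℝ (fun p => coord N k p / 2 * D l p) (D l)) +
      SchwartzMap.smulLeftCLM ℝ (fun p => coord N k p / 2 * (‖p.1‖ ^ 2 * v p)) v), ?_⟩
  funext p
  simp only [sub_apply, add_apply, sum_apply, SchwartzMap.smulLeftCLM_apply_apply h1, SchwartzMap.smulLeftCLM_apply_apply (h2 _),
    SchwartzMap.smulLeftCLM_apply_apply h3, smul_eq_mul]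
  simp only [D, SchwartzMap.lineDerivOp_apply_eq_fderiv, pohozaevFlux, mul_add, Finset.mul_sum,
    Finset.sum_mul]
  congr 1
  · exact Finset.sum_congr rfl fun l _ => by ring
  · congr 1
    · exact Finset.sum_congr rfl fun l _ => by ring
    · ring

/-- Half the derivative of `‖x‖²` in the coordinate directions. -/
def horizontalCoord (N : ℕ) (p : RN1 N) : Option (Fin N) → ℝ
  | none => 0
  | some i => p.1 i

lemma hasLineDerivAt_norm_fst_sq (N : ℕ) (p : RN1 N) (k : Option (Fin N)) :
    HasLineDerivAt ℝ (fun q : RN1 N => ‖q.1‖ ^ 2) (2 * horizontalCoord N p k) p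
      (coordDir N k) := by
  have h : HasLineDerivAt ℝ (fun q : RN1 N => ‖q.1‖ ^ 2) _ p (coordDir N k) :=
    (hasFDerivAt_fst (𝕜 := ℝ) (E := RN N) (F := ℝ) (p := p)).norm_sq.hasLineDerivAt _
  convert h using 1
  cases k <;> simp [horizontalCoord, coordDir, dirX, dirY, EuclideanSpace.inner_single_right]

lemma sum_coord_mul_horizontalCoord (N : ℕ) (p : RN1 N) :
    ∑ k, coord N k p * horizontalCoord N p k = ‖p.1‖ ^ 2 := by
  rw [EuclideanSpace.real_norm_sq_eq]
  simp [Fintype.sum_option, horizontalCoord, coord, sq]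

lemma fderiv_pohozaevFlux (N : ℕ) (v : 𝓢(RN1 N, ℝ)) (k : Option (Fin N)) (p : RN1 N) :
    fderiv ℝ (pohozaevFlux N v k) p (coordDir N k) =
      fderiv ℝ (fun q => fderiv ℝ v q (coordDir N k)) p (coordDir N k) *
          ∑ l, coord N l p * fderiv ℝ v p (coordDir N l) +
        fderiv ℝ v p (coordDir N k) * (fderiv ℝ v p (coordDir N k) +
          ∑ l, coord N l p *
            fderiv ℝ (fun q => fderiv ℝ v q (coordDir N l)) p (coordDir N k)) -
      (1 / 2 * (∑ l, fderiv ℝ v p (coordDir N l) ^ 2 + ‖p.1‖ ^ 2 * v p ^ 2) +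
        coord N k p * (∑ l, fderiv ℝ v p (coordDir N l) *
            fderiv ℝ (fun q => fderiv ℝ v q (coordDir N l)) p (coordDir N k) +
          (horizontalCoord N p k * v p ^ 2 +
            ‖p.1‖ ^ 2 * v p * fderiv ℝ v p (coordDir N k)))) := by
  have hv : HasLineDerivAt ℝ v (fderiv ℝ v p (coordDir N k)) p (coordDir N k) :=
    (v.hasFDerivAt p).hasLineDerivAt _
  have hD (l) : HasLineDerivAt ℝ (fun q => fderiv ℝ v q (coordDir N l))
      (fderiv ℝ (fun q => fderiv ℝ v q (coordDir N l)) p (coordDir N k)) p (coordDir N k) := by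
    simpa only [SchwartzMap.lineDerivOp_apply_eq_fderiv, funext
      fun q => SchwartzMap.lineDerivOp_apply_eq_fderiv (coordDir N l) v q] using
      ((∂_{coordDir N l} v : 𝓢(RN1 N, ℝ)).hasFDerivAt p).hasLineDerivAt (coordDir N k)
  have hc (l) : HasLineDerivAt ℝ (coord N l) (if l = k then 1 else 0) p (coordDir N k) := by
    rw [← coord_coordDir]
    exact (coord N l).hasFDerivAt.hasLineDerivAt _
  have hw := hasLineDerivAt_norm_fst_sq N p k
  obtain ⟨F, hF⟩ := exists_schwartz_pohozaevFlux N v k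
  have hF' : HasLineDerivAt ℝ (pohozaevFlux N v k)
      (fderiv ℝ (pohozaevFlux N v k) p (coordDir N k)) p (coordDir N k) := by
    rw [← hF]
    exact (F.hasFDerivAt p).hasLineDerivAt _
  have hmain : HasDerivAt (fun t : ℝ => pohozaevFlux N v k (p + t • coordDir N k)) _ 0 :=
    ((hD k).mul (HasDerivAt.fun_sum fun l (_ : l ∈ Finset.univ) =>
      HasDerivAt.mul (hc l) (hD l))).sub
      ((HasDerivAt.div_const (hc k) 2).mul
        ((HasDerivAt.fun_sum fun l (_ : l ∈ Finset.univ) => HasDerivAt.pow (hD l) 2).add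
          (HasDerivAt.mul hw (HasDerivAt.pow hv 2))))
  rw [HasDerivAt.unique hF' hmain]
  simp only [zero_smul, add_zero, Pi.mul_apply, Finset.sum_add_distrib, ite_mul, one_mul, zero_mul,
    Finset.sum_ite_eq', Finset.mem_univ, if_true, Nat.cast_ofNat, Nat.add_one_sub_one, pow_one,
    mul_assoc, ← Finset.mul_sum]
  ring

/-- The divergence of the Pohozaev flux. -/
lemma sum_fderiv_pohozaevFlux (N : ℕ) (v : 𝓢(RN1 N, ℝ)) (p : RN1 N)
    (hpde : -lap N v p + ‖p.1‖ ^ 2 * v p = 0) :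
    ∑ k, fderiv ℝ (pohozaevFlux N v k) p (coordDir N k) =
      -(((N : ℝ) - 1) / 2 * gradSq N v p + ((N : ℝ) + 3) / 2 * (‖p.1‖ ^ 2 * v p ^ 2)) := by
  have hgrad : ∑ l, fderiv ℝ v p (coordDir N l) ^ 2 = gradSq N v p := by
    simp [Fintype.sum_option, gradSq, coordDir, add_comm]
  have hlap : ∑ l, fderiv ℝ (fun q => fderiv ℝ v q (coordDir N l)) p (coordDir N l) =
      ‖p.1‖ ^ 2 * v p := by
    rw [sub_eq_zero.mp ((neg_add_eq_sub _ _).symm.trans hpde)]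
    simp [Fintype.sum_option, lap, coordDir, add_comm]
  have hsymm (k l) : fderiv ℝ (fun q => fderiv ℝ v q (coordDir N l)) p (coordDir N k) =
      fderiv ℝ (fun q => fderiv ℝ v q (coordDir N k)) p (coordDir N l) := by
    have hd : DifferentiableAt ℝ (fderiv ℝ v) p :=
      ((v.smooth 2).fderiv_right (m := 1) le_rfl).differentiable one_ne_zero p
    rw [fderiv_clm_apply hd (differentiableAt_const _),
      fderiv_clm_apply hd (differentiableAt_const _)]
    simpa using (v.smooth 2).contDiffAt.isSymmSndFDerivAt (by simp) (coordDir N k) (coordDir N l)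
  have hcomm : ∑ k, fderiv ℝ v p (coordDir N k) * ∑ l, coord N l p *
        fderiv ℝ (fun q => fderiv ℝ v q (coordDir N l)) p (coordDir N k) =
      ∑ k, coord N k p * ∑ l, fderiv ℝ v p (coordDir N l) *
        fderiv ℝ (fun q => fderiv ℝ v q (coordDir N l)) p (coordDir N k) := by
    simp only [Finset.mul_sum]
    rw [Finset.sum_comm]
    refine Finset.sum_congr rfl fun k _ => Finset.sum_congr rfl fun l _ => ?_
    rw [hsymm k l]
    ring
  have hrad := sum_coord_mul_horizontalCoord N p
  have hv : ∑ k, coord N k p * (horizontalCoord N p k * v p ^ 2 +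
        ‖p.1‖ ^ 2 * v p * fderiv ℝ v p (coordDir N k)) =
      ‖p.1‖ ^ 2 * v p ^ 2 +
        ‖p.1‖ ^ 2 * v p * ∑ l, coord N l p * fderiv ℝ v p (coordDir N l) := by
    nth_rw 2 [← hrad]
    rw [Finset.mul_sum, Finset.sum_mul, ← Finset.sum_add_distrib]
    exact Finset.sum_congr rfl fun k _ => by ring
  simp only [fderiv_pohozaevFlux, Finset.sum_sub_distrib, Finset.sum_add_distrib, mul_add,
    ← Finset.sum_mul, hlap, hcomm] at hv ⊢
  simp only [← mul_add, ← pow_two, hgrad, Finset.sum_const, Finset.card_univ,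
    Fintype.card_option, Fintype.card_fin, nsmul_eq_mul, Nat.cast_add, Nat.cast_one]
  linear_combination -hv

theorem stmt6 (N : ℕ) (hN : 2 ≤ N) (f : RN N → ℝ → ℝ)
    (hf : Continuous (Function.uncurry f))
    (a b θ : ℝ) (ha : 0 < a) (hb : 0 < b) (hθ : 2 < θ) (hθ' : θ < twoStar N)
    (hgrowth : ∀ x t, |f x t| ≤ a * |t| + b * |t| ^ (θ - 1))
    (v : SchwartzMap (RN1 N) ℝ)
    (hpde : ∀ p : RN1 N, 0 < p.2 → -lap N v p + ‖p.1‖ ^ 2 * v p = 0)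
    (hbdry : ∀ x : RN N, -(fderiv ℝ (v : RN1 N → ℝ) (x, 0) (dirY N)) = f x (v (x, 0))) :
    ((N : ℝ) - 1) / 2 * (∫ p in upperHalf N, gradSq N v p) +
      ((N : ℝ) + 3) / 2 * (∫ p in upperHalf N, ‖p.1‖ ^ 2 * (v p) ^ 2) =
      -∫ x : RN N,
        ∑ i : Fin N, x i * fderiv ℝ (v : RN1 N → ℝ) (x, 0) (dirX N i) * f x (v (x, 0)) := by
  choose F hF using exists_schwartz_pohozaevFlux N v
  have hFint (k) : Integrable (fun p => fderiv ℝ (F k) p (coordDir N k)) := by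
    simpa only [← SchwartzMap.lineDerivOp_apply_eq_fderiv] using
      (∂_{coordDir N k} (F k) : 𝓢(RN1 N, ℝ)).integrable (μ := volume)
  have hD (m : RN1 N) : Integrable (fun p => fderiv ℝ v p m ^ 2) := by
    have := (SchwartzMap.smulLeftCLM ℝ (∂_{m} v : 𝓢(RN1 N, ℝ)) (∂_{m} v)).integrable (μ := volume)
    rw [SchwartzMap.smulLeftCLM_apply (SchwartzMap.hasTemperateGrowth _)] at this
    simpa only [SchwartzMap.lineDerivOp_apply_eq_fderiv, smul_eq_mul, ← sq] using this
  have hgrad : Integrable (gradSq N v) :=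
    (integrable_finsetSum _ fun i _ => hD (dirX N i)).add (hD (dirY N))
  have hpot : Integrable (fun p : RN1 N => ‖p.1‖ ^ 2 * v p ^ 2) := by
    have hg : Function.HasTemperateGrowth (fun p : RN1 N => ‖p.1‖ ^ 2 * v p) :=
      (hasTemperateGrowth_norm_fst_sq N).mul v.hasTemperateGrowth
    have := (SchwartzMap.smulLeftCLM ℝ (fun p => ‖p.1‖ ^ 2 * v p) v).integrable (μ := volume)
    rw [SchwartzMap.smulLeftCLM_apply hg] at this
    simpa only [smul_eq_mul, mul_assoc, ← sq] using this
  have hdiv : ∫ p in upperHalf N, ∑ k, fderiv ℝ (F k) p (coordDir N k) =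
      -∫ x : RN N, F none (x, 0) := by
    rw [integral_finsetSum _ fun k _ => (hFint k).integrableOn, Fintype.sum_option]
    simp [coordDir, setIntegral_fderiv_dirX, setIntegral_fderiv_dirY]
  have hbulk : ∫ p in upperHalf N, ∑ k, fderiv ℝ (F k) p (coordDir N k) =
      -(((N : ℝ) - 1) / 2 * (∫ p in upperHalf N, gradSq N v p) +
        ((N : ℝ) + 3) / 2 * (∫ p in upperHalf N, ‖p.1‖ ^ 2 * (v p) ^ 2)) := by
    rw [← integral_const_mul, ← integral_const_mul, ← integral_add
      (hgrad.integrableOn.const_mul _) (hpot.integrableOn.const_mul _), ← integral_neg]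
    refine setIntegral_congr_fun (measurableSet_upperHalf N) fun p hp => ?_
    simp only [hF]
    exact sum_fderiv_pohozaevFlux N v p (hpde p hp)
  have htrace : ∫ x : RN N, F none (x, 0) = -∫ x : RN N,
      ∑ i : Fin N, x i * fderiv ℝ (v : RN1 N → ℝ) (x, 0) (dirX N i) * f x (v (x, 0)) := by
    rw [← integral_neg]
    congr 1 with x
    rw [hF, ← Finset.sum_mul, ← hbdry]
    simp [pohozaevFlux, coord, coordDir, Fintype.sum_option]
    ring
  linarith
end
end

section
/- Let p ≥ 2, and let v : ℝ^{N+1} → ℝ be a Schwartz function such that −Δv(x,y) + |x|² v(x,y) = 0 for all (x,y) with y > 0 and −∂v/∂y(x,0) = |v(x,0)|^{p−2} v(x,0) for all x ∈ ℝ^N. Then (N/p − (N−1)/2) ∫_{ℝ^N} |v(x,0)|^{p} dx = 2 ∬_{ℝ^{N+1}_+} |x|² v² dx dy. -/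
open MeasureTheory

noncomputable section

open scoped SchwartzMap LineDeriv

/-- The function `f` is (the coercion of) a real-valued Schwartz function. -/
def IsSchwartz {E : Type*} [NormedAddCommGroup E] [NormedSpace ℝ E] (f : E → ℝ) : Prop :=
  ∃ F : 𝓢(E, ℝ), ⇑F = f

namespace IsSchwartz

variable {E : Type*} [NormedAddCommGroup E] [NormedSpace ℝ E] {f g : E → ℝ}

lemma add (hf : IsSchwartz f) (hg : IsSchwartz g) : IsSchwartz (fun x => f x + g x) := by
  obtain ⟨F, rfl⟩ := hf
  obtain ⟨G, rfl⟩ := hg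
  exact ⟨F + G, rfl⟩

lemma sub (hf : IsSchwartz f) (hg : IsSchwartz g) : IsSchwartz (fun x => f x - g x) := by
  obtain ⟨F, rfl⟩ := hf
  obtain ⟨G, rfl⟩ := hg
  exact ⟨F - G, rfl⟩

lemma temperate_mul (hf : f.HasTemperateGrowth) (hg : IsSchwartz g) :
    IsSchwartz (fun x => f x * g x) := by
  obtain ⟨G, rfl⟩ := hg
  exact ⟨SchwartzMap.smulLeftCLM ℝ f G, by
    ext x; simp [SchwartzMap.smulLeftCLM_apply_apply hf]⟩

lemma mul (hf : IsSchwartz f) (hg : IsSchwartz g) : IsSchwartz (fun x => f x * g x) := by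
  obtain ⟨F, rfl⟩ := hf
  exact temperate_mul F.hasTemperateGrowth hg

lemma clm_mul (L : E →L[ℝ] ℝ) (hg : IsSchwartz g) : IsSchwartz (fun x => L x * g x) :=
  temperate_mul L.hasTemperateGrowth hg

lemma const_mul (c : ℝ) (hg : IsSchwartz g) : IsSchwartz (fun x => c * g x) :=
  temperate_mul (Function.HasTemperateGrowth.const c) hg

lemma sum {ι : Type*} (s : Finset ι) {f : ι → E → ℝ} (hf : ∀ i ∈ s, IsSchwartz (f i)) :
    IsSchwartz (fun x => ∑ i ∈ s, f i x) := by
  classical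
  induction s using Finset.induction_on with
  | empty => exact ⟨0, by ext; simp⟩
  | insert a s ha ih =>
    simp only [Finset.sum_insert ha]
    exact (hf a (by simp)).add (ih fun i hi => hf i (by simp [hi]))

lemma fderiv_apply (hf : IsSchwartz f) (w : E) : IsSchwartz (fun x => fderiv ℝ f x w) := by
  obtain ⟨F, rfl⟩ := hf
  exact ⟨∂_{w} F, by ext x; exact SchwartzMap.lineDerivOp_apply_eq_fderiv w F x⟩

lemma contDiff (hf : IsSchwartz f) : ContDiff ℝ 2 f := by
  obtain ⟨F, rfl⟩ := hf
  exact F.smooth 2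

lemma differentiable (hf : IsSchwartz f) : Differentiable ℝ f :=
  hf.contDiff.differentiable (by norm_num)

lemma hasDerivAt_line (hf : IsSchwartz f) (x w : E) :
    HasDerivAt (fun t : ℝ => f (x + t • w)) (fderiv ℝ f x w) 0 :=
  (hf.differentiable x).hasFDerivAt.hasLineDerivAt w

lemma fderiv_eq_of_line (hf : IsSchwartz f) {x w : E} {c : ℝ}
    (h : HasDerivAt (fun t : ℝ => f (x + t • w)) c 0) : fderiv ℝ f x w = c :=
  (hf.hasDerivAt_line x w).unique h

lemma fderiv_comm (hf : IsSchwartz f) (x w w' : E) :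
    fderiv ℝ (fun y => fderiv ℝ f y w) x w' = fderiv ℝ (fun y => fderiv ℝ f y w') x w := by
  have hd : DifferentiableAt ℝ (fderiv ℝ f) x :=
    (hf.contDiff.fderiv_right (m := 1) (by norm_num)).differentiable (by norm_num) x
  have hs := hf.contDiff.contDiffAt.isSymmSndFDerivAt (x := x) (by simp)
  rw [fderiv_clm_apply hd (by fun_prop), fderiv_clm_apply hd (by fun_prop)]
  simpa using hs w' w

lemma integrable [FiniteDimensional ℝ E] [MeasurableSpace E] [BorelSpace E] {μ : Measure E}
    [μ.IsAddHaarMeasure] (hf : IsSchwartz f) : Integrable f μ := by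
  obtain ⟨F, rfl⟩ := hf
  exact F.integrable

end IsSchwartz

/-- A differentiable function which is integrable, as is its derivative in the direction `w`,
has a directional derivative of integral zero. -/
lemma integral_fderiv_apply_eq_zero {E : Type*} [NormedAddCommGroup E] [NormedSpace ℝ E]
    [FiniteDimensional ℝ E] [MeasurableSpace E] [BorelSpace E] {μ : Measure E}
    [μ.IsAddHaarMeasure] {f : E → ℝ} (w : E) (hd : Differentiable ℝ f) (hf : Integrable f μ)
    (hf' : Integrable (fun x => fderiv ℝ f x w) μ) : ∫ x, fderiv ℝ f x w ∂μ = 0 := by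
  have := integral_mul_fderiv_eq_neg_fderiv_mul_of_integrable (μ := μ) (v := w)
    (f := fun _ : E => (1 : ℝ)) (g := f) (by simp) (by simpa using hf') (by simpa using hf)
    (fun x _ => by fun_prop) (fun x _ => hd x)
  simpa using this

lemma volume_restrict_upperHalf (N : ℕ) :
    (volume : Measure (RN1 N)).restrict (upperHalf N) =
      (volume : Measure (RN N)).prod (volume.restrict (Set.Ioi (0 : ℝ))) := by
  have : upperHalf N = Set.univ ×ˢ Set.Ioi (0 : ℝ) := by ext; simp [upperHalf]
  rw [this, Measure.volume_eq_prod, ← Measure.prod_restrict, Measure.restrict_univ]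

lemma setIntegral_upperHalf_fderiv_horizontal {N : ℕ} {f : RN1 N → ℝ} (hf : IsSchwartz f)
    (w : RN N) : ∫ q in upperHalf N, fderiv ℝ f q (w, 0) = 0 := by
  have hi := (hf.integrable (μ := volume)).integrableOn (s := upperHalf N)
  have hi' := ((hf.fderiv_apply (w, 0)).integrable (μ := volume)).integrableOn (s := upperHalf N)
  rw [IntegrableOn, volume_restrict_upperHalf] at hi hi'
  rw [volume_restrict_upperHalf, integral_prod_symm _ hi']
  refine integral_eq_zero_of_ae ?_
  filter_upwards [hi.prod_left_ae, hi'.prod_left_ae] with y h h'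
  have key (x : RN N) : HasFDerivAt (fun x => f (x, y))
      ((fderiv ℝ f (x, y)).comp (ContinuousLinearMap.inl ℝ (RN N) ℝ)) x :=
    (hf.differentiable (x, y)).hasFDerivAt.comp x (hasFDerivAt_prodMk_left x y)
  have key' (x : RN N) : fderiv ℝ f (x, y) (w, 0) = fderiv ℝ (fun x => f (x, y)) x w := by
    rw [(key x).fderiv]; simp
  simp only [key'] at h' ⊢
  exact integral_fderiv_apply_eq_zero w (fun x => (key x).differentiableAt) h h'

lemma setIntegral_upperHalf_fderiv_vertical {N : ℕ} {f : RN1 N → ℝ} (hf : IsSchwartz f) :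
    ∫ q in upperHalf N, fderiv ℝ f q (dirY N) = -∫ x : RN N, f (x, 0) := by
  have hi := (hf.integrable (μ := volume)).integrableOn (s := upperHalf N)
  have hi' := ((hf.fderiv_apply (dirY N)).integrable (μ := volume)).integrableOn
    (s := upperHalf N)
  rw [IntegrableOn, volume_restrict_upperHalf] at hi hi'
  rw [volume_restrict_upperHalf, integral_prod _ hi', ← integral_neg]
  refine integral_congr_ae ?_
  filter_upwards [hi.prod_right_ae, hi'.prod_right_ae] with x h h'
  have key (y : ℝ) : HasDerivAt (fun y => f (x, y)) (fderiv ℝ f (x, y) (dirY N)) y :=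
    (hf.differentiable (x, y)).hasFDerivAt.comp_hasDerivAt y
      ((hasDerivAt_const y x).prodMk (hasDerivAt_id y))
  rw [integral_Ioi_of_hasDerivAt_of_tendsto' (fun y _ => key y) h'
    (tendsto_zero_of_hasDerivAt_of_integrableOn_Ioi (fun y _ => key y) h' h)]
  simp

/-- The coordinate functionals on `ℝ^{N+1}`, indexed so that `none` is the vertical one. -/
def coordCLM (N : ℕ) : Option (Fin N) → RN1 N →L[ℝ] ℝ
  | none => ContinuousLinearMap.snd ℝ (RN N) ℝ
  | some i => (EuclideanSpace.proj i).comp (ContinuousLinearMap.fst ℝ (RN N) ℝ)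

/-- The coordinate directions of `ℝ^{N+1}`, indexed so that `none` is the vertical one. -/
def dir (N : ℕ) : Option (Fin N) → RN1 N
  | none => dirY N
  | some i => dirX N i

lemma coordCLM_dir (N : ℕ) (j k : Option (Fin N)) :
    coordCLM N j (dir N k) = if j = k then 1 else 0 := by
  rcases j with _ | j <;> rcases k with _ | k <;>
    simp [coordCLM, dir, dirX, dirY]

lemma norm_fst_sq (N : ℕ) (q : RN1 N) : ‖q.1‖ ^ 2 = ∑ i, coordCLM N (some i) q ^ 2 := by
  simp [EuclideanSpace.norm_sq_eq, coordCLM]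

lemma lap_eq_sum (N : ℕ) (v : RN1 N → ℝ) (q : RN1 N) :
    lap N v q = ∑ k, fderiv ℝ (fun q => fderiv ℝ v q (dir N k)) q (dir N k) := by
  rw [lap, Fintype.sum_option, add_comm]
  rfl

/-- The divergence theorem on the half-space for Schwartz vector fields. -/
lemma setIntegral_upperHalf_divergence {N : ℕ} {Q : Option (Fin N) → RN1 N → ℝ}
    (hQ : ∀ k, IsSchwartz (Q k)) :
    ∫ q in upperHalf N, ∑ k, fderiv ℝ (Q k) q (dir N k) = -∫ x : RN N, Q none (x, 0) := by
  rw [integral_finsetSum _ fun k _ =>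
    (((hQ k).fderiv_apply (dir N k)).integrable (μ := volume)).integrableOn,
    Fintype.sum_option]
  have h (i : Fin N) : ∫ q in upperHalf N, fderiv ℝ (Q (some i)) q (dir N (some i)) = 0 :=
    setIntegral_upperHalf_fderiv_horizontal (hQ (some i)) _
  simp only [h, Finset.sum_const_zero, add_zero]
  exact setIntegral_upperHalf_fderiv_vertical (hQ none)

/-- The Pohozaev vector field of `v`, corrected by a multiple of `v ∇v`. -/
def pohozaevField (N : ℕ) (v : RN1 N → ℝ) (k : Option (Fin N)) (q : RN1 N) : ℝ :=
  (∑ j, coordCLM N j q * fderiv ℝ v q (dir N j)) * fderiv ℝ v q (dir N k) -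
    coordCLM N k q * ((1 / 2) * ((∑ j, fderiv ℝ v q (dir N j) * fderiv ℝ v q (dir N j)) +
      ∑ i, coordCLM N (some i) q * (coordCLM N (some i) q * (v q * v q)))) +
    ((N - 1) / 2 : ℝ) * (v q * fderiv ℝ v q (dir N k))

lemma isSchwartz_pohozaevField {N : ℕ} {v : RN1 N → ℝ} (hv : IsSchwartz v)
    (k : Option (Fin N)) : IsSchwartz (pohozaevField N v k) := by
  have hd (j) := hv.fderiv_apply (dir N j)
  refine .add (.sub (.mul (.sum _ fun j _ => (hd j).clm_mul _) (hd k)) (.clm_mul _ (.const_mul _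
    (.add (.sum _ fun j _ => (hd j).mul (hd j))
      (.sum _ fun i _ => .clm_mul _ (.clm_mul _ (hv.mul hv))))))) (.const_mul _ (hv.mul (hd k)))

lemma fderiv_pohozaevField {N : ℕ} {v : RN1 N → ℝ} (hv : IsSchwartz v)
    (k : Option (Fin N)) (q : RN1 N) :
    fderiv ℝ (pohozaevField N v k) q (dir N k) =
      (fderiv ℝ v q (dir N k) + ∑ j, coordCLM N j q *
        fderiv ℝ (fun q => fderiv ℝ v q (dir N j)) q (dir N k)) * fderiv ℝ v q (dir N k) +
      (∑ j, coordCLM N j q * fderiv ℝ v q (dir N j)) *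
        fderiv ℝ (fun q => fderiv ℝ v q (dir N k)) q (dir N k) -
      (1 / 2) * ((∑ j, fderiv ℝ v q (dir N j) ^ 2) + ‖q.1‖ ^ 2 * v q ^ 2) -
      coordCLM N k q * (∑ j, fderiv ℝ v q (dir N j) *
        fderiv ℝ (fun q => fderiv ℝ v q (dir N j)) q (dir N k)) -
      (if k = none then 0 else coordCLM N k q ^ 2) * v q ^ 2 -
      ‖q.1‖ ^ 2 * v q * (coordCLM N k q * fderiv ℝ v q (dir N k)) +
      ((N - 1) / 2 : ℝ) * (fderiv ℝ v q (dir N k) ^ 2 +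
        v q * fderiv ℝ (fun q => fderiv ℝ v q (dir N k)) q (dir N k)) := by
  apply (isSchwartz_pohozaevField hv k).fderiv_eq_of_line
  have hV := hv.hasDerivAt_line q (dir N k)
  have hd (j) := (hv.fderiv_apply (dir N j)).hasDerivAt_line q (dir N k)
  have hz (j) : HasDerivAt (fun t : ℝ => coordCLM N j (q + t • dir N k))
      (if j = k then 1 else 0) 0 := by
    rw [← coordCLM_dir]
    exact (coordCLM N j).hasFDerivAt.hasLineDerivAt (dir N k)
  have hS : HasDerivAt (fun t : ℝ => ∑ j, coordCLM N j (q + t • dir N k) *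
      fderiv ℝ v (q + t • dir N k) (dir N j)) (fderiv ℝ v q (dir N k) + ∑ j, coordCLM N j q *
        fderiv ℝ (fun q => fderiv ℝ v q (dir N j)) q (dir N k)) 0 := by
    refine (HasDerivAt.fun_sum fun j _ => (hz j).fun_mul (hd j)).congr_deriv ?_
    simp [Finset.sum_add_distrib]
  have hA : HasDerivAt (fun t : ℝ => ∑ j, fderiv ℝ v (q + t • dir N k) (dir N j) *
      fderiv ℝ v (q + t • dir N k) (dir N j)) (2 * ∑ j, fderiv ℝ v q (dir N j) *
        fderiv ℝ (fun q => fderiv ℝ v q (dir N j)) q (dir N k)) 0 := by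
    refine (HasDerivAt.fun_sum fun j _ => (hd j).fun_mul (hd j)).congr_deriv ?_
    rw [Finset.mul_sum]
    refine Finset.sum_congr rfl fun j _ => ?_
    simp only [zero_smul, add_zero]
    ring
  have hR : HasDerivAt (fun t : ℝ => ∑ i, coordCLM N (some i) (q + t • dir N k) *
      (coordCLM N (some i) (q + t • dir N k) * (v (q + t • dir N k) * v (q + t • dir N k))))
      (2 * (∑ i, (if some i = k then 1 else 0) * coordCLM N (some i) q) * v q ^ 2 +
        2 * ‖q.1‖ ^ 2 * v q * fderiv ℝ v q (dir N k)) 0 := by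
    refine (HasDerivAt.fun_sum fun i _ => (hz (some i)).fun_mul ((hz (some i)).fun_mul
      (hV.fun_mul hV))).congr_deriv ?_
    rw [norm_fst_sq]
    simp only [Finset.mul_sum, Finset.sum_mul, ← Finset.sum_add_distrib]
    refine Finset.sum_congr rfl fun i _ => ?_
    simp only [zero_smul, add_zero]
    ring
  refine (((hS.mul (hd k)).sub ((hz k).mul ((hA.add hR).const_mul (1 / 2)))).add
    ((hV.mul (hd k)).const_mul ((N - 1) / 2 : ℝ))).congr_deriv ?_
  have hk : (if k = none then 0 else coordCLM N k q ^ 2) =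
      coordCLM N k q * ∑ i, (if some i = k then 1 else 0) * coordCLM N (some i) q := by
    rcases k with _ | k <;> simp [sq]
  have hr : ∑ i, coordCLM N (some i) q * (coordCLM N (some i) q * (v q * v q)) =
      ‖q.1‖ ^ 2 * v q ^ 2 := by
    rw [norm_fst_sq, Finset.sum_mul]
    exact Finset.sum_congr rfl fun i _ => by ring
  rw [hk]
  simp only [zero_smul, add_zero, if_true, Pi.add_apply, hr]
  simp only [← sq]
  ring

lemma sum_pohozaev_identity {ι : Type*} [Fintype ι] (a z r : ι → ℝ) (h : ι → ι → ℝ)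
    (hs : ∀ j k, h j k = h k j) (u R c : ℝ) (hr : ∑ k, r k = R) :
    ∑ k, ((a k + ∑ j, z j * h j k) * a k + (∑ j, z j * a j) * h k k -
      (1 / 2) * ((∑ j, a j ^ 2) + R * u ^ 2) - z k * (∑ j, a j * h j k) - r k * u ^ 2 -
      R * u * (z k * a k) + c * (a k ^ 2 + u * h k k)) =
    (∑ j, a j ^ 2) + (∑ j, z j * a j) * (∑ k, h k k) -
      Fintype.card ι * ((1 / 2) * ((∑ j, a j ^ 2) + R * u ^ 2)) - R * u ^ 2 -
      R * u * (∑ k, z k * a k) + c * ((∑ k, a k ^ 2) + u * ∑ k, h k k) := by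
  have hT : ∑ k, (∑ j, z j * h j k) * a k = ∑ k, z k * ∑ j, a j * h j k := by
    simp only [Finset.sum_mul, Finset.mul_sum]
    rw [Finset.sum_comm]
    refine Finset.sum_congr rfl fun j _ => Finset.sum_congr rfl fun k _ => ?_
    rw [hs]; ring
  simp only [add_mul, Finset.sum_add_distrib, Finset.sum_sub_distrib, hT, ← Finset.mul_sum,
    ← Finset.sum_mul, hr, Finset.sum_const, Finset.card_univ, nsmul_eq_mul, ← sq]
  ring

lemma divergence_pohozaevField {N : ℕ} {v : RN1 N → ℝ} (hv : IsSchwartz v) {q : RN1 N}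
    (hq : -lap N v q + ‖q.1‖ ^ 2 * v q = 0) :
    ∑ k, fderiv ℝ (pohozaevField N v k) q (dir N k) = -2 * (‖q.1‖ ^ 2 * v q ^ 2) := by
  simp only [fderiv_pohozaevField hv]
  rw [sum_pohozaev_identity (fun k => fderiv ℝ v q (dir N k)) (fun k => coordCLM N k q)
    (fun k => if k = none then 0 else coordCLM N k q ^ 2)
    (fun j k => fderiv ℝ (fun q => fderiv ℝ v q (dir N j)) q (dir N k))
    (fun j k => hv.fderiv_comm q _ _) (v q) (‖q.1‖ ^ 2) _
    (by simp [Fintype.sum_option, norm_fst_sq]), ← lap_eq_sum,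
    show lap N v q = ‖q.1‖ ^ 2 * v q by linarith]
  simp only [Fintype.card_option, Fintype.card_fin]
  push_cast
  ring

lemma pohozaevField_none_boundary {N : ℕ} (v : RN1 N → ℝ) (x : RN N) :
    pohozaevField N v none (x, 0) =
      fderiv ℝ v (x, 0) (dirY N) * (∑ i, x i * fderiv ℝ v (x, 0) (dirX N i)) +
        ((N - 1) / 2 : ℝ) * (v (x, 0) * fderiv ℝ v (x, 0) (dirY N)) := by
  simp [pohozaevField, coordCLM, dir, Fintype.sum_option, mul_comm]

lemma IsSchwartz.trace {N : ℕ} {v : RN1 N → ℝ} (hv : IsSchwartz v) :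
    IsSchwartz (fun x : RN N => v (x, 0)) := by
  obtain ⟨F, rfl⟩ := hv
  have h : AntilipschitzWith 1 (fun x : RN N => ((x, 0) : RN1 N)) :=
    AntilipschitzWith.of_le_mul_dist fun x y => by simp [Prod.dist_eq]
  exact ⟨SchwartzMap.compCLMOfAntilipschitz ℝ
    (ContinuousLinearMap.inl ℝ (RN N) ℝ).hasTemperateGrowth h F, rfl⟩

lemma fderiv_trace {N : ℕ} {v : RN1 N → ℝ} (hv : IsSchwartz v) (x : RN N) (i : Fin N) :
    fderiv ℝ (fun x : RN N => v (x, 0)) x (EuclideanSpace.single i 1) =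
      fderiv ℝ v (x, 0) (dirX N i) := by
  have key : HasFDerivAt (fun x : RN N => v (x, 0))
      ((fderiv ℝ v (x, 0)).comp (ContinuousLinearMap.inl ℝ (RN N) ℝ)) x :=
    (hv.differentiable (x, 0)).hasFDerivAt.comp x (hasFDerivAt_prodMk_left x 0)
  rw [key.fderiv]
  simp [dirX]

lemma abs_rpow_eq_mul_sq {p : ℝ} (hp : 2 ≤ p) (t : ℝ) : |t| ^ p = |t| ^ (p - 2) * (t * t) := by
  rcases eq_or_ne t 0 with rfl | ht
  · simp [Real.zero_rpow (by linarith : p ≠ 0)]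
  · rw [Real.rpow_sub (abs_pos.2 ht), Real.rpow_two, sq_abs]
    field_simp

section Trace

variable {E : Type*} [NormedAddCommGroup E] [NormedSpace ℝ E] [FiniteDimensional ℝ E]
  [MeasurableSpace E] [BorelSpace E] {μ : Measure E} [μ.IsAddHaarMeasure] {w g : E → ℝ} {p : ℝ}

lemma IsSchwartz.integrable_abs_rpow_mul {s : ℝ} (hs : 0 ≤ s) (hw : IsSchwartz w)
    (hg : IsSchwartz g) : Integrable (fun x => |w x| ^ s * g x) μ := by
  obtain ⟨C, hC⟩ : ∃ C, ∀ x, |w x| ≤ C := by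
    obtain ⟨F, rfl⟩ := hw
    exact ⟨_, fun x => F.norm_le_seminorm ℝ x⟩
  refine hg.integrable.bdd_mul (c := C ^ s) ?_ (.of_forall fun x => ?_)
  · exact (hw.differentiable.continuous.abs.rpow_const fun _ => .inr hs).aestronglyMeasurable
  · rw [Real.norm_of_nonneg (by positivity)]
    gcongr
    exact hC x

lemma IsSchwartz.integrable_abs_rpow (hp : 2 ≤ p) (hw : IsSchwartz w) :
    Integrable (fun x => |w x| ^ p) μ := by
  simp only [abs_rpow_eq_mul_sq hp]
  exact hw.integrable_abs_rpow_mul (by linarith) (hw.mul hw)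

lemma integral_clm_mul_fderiv_abs_rpow (hp : 2 ≤ p) (hw : IsSchwartz w) (L : E →L[ℝ] ℝ) (e : E)
    (hLe : L e = 1) : p * ∫ x, |w x| ^ (p - 2) * w x * (L x * fderiv ℝ w x e) ∂μ =
      -∫ x, |w x| ^ p ∂μ := by
  have hd (x : E) : HasFDerivAt (fun x => L x * |w x| ^ p)
      (L x • (p * |w x| ^ (p - 2) * w x) • fderiv ℝ w x + |w x| ^ p • L) x :=
    L.hasFDerivAt.mul ((hasDerivAt_abs_rpow (w x) (by linarith)).comp_hasFDerivAt x
      (hw.differentiable x).hasFDerivAt)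
  have hf (x : E) : fderiv ℝ (fun x => L x * |w x| ^ p) x e =
      p * (|w x| ^ (p - 2) * w x * (L x * fderiv ℝ w x e)) + |w x| ^ p := by
    rw [(hd x).fderiv]
    simp [hLe]
    ring
  have hi : Integrable (fun x => |w x| ^ (p - 2) * w x * (L x * fderiv ℝ w x e)) μ := by
    simp only [mul_assoc]
    exact hw.integrable_abs_rpow_mul (by linarith) (hw.mul ((hw.fderiv_apply e).clm_mul L))
  have hi0 : Integrable (fun x => L x * |w x| ^ p) μ := by
    have h := hw.integrable_abs_rpow_mul (μ := μ) (sub_nonneg.2 hp) ((hw.mul hw).clm_mul L)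
    refine h.congr (.of_forall fun x => ?_)
    change _ = L x * |w x| ^ p
    rw [abs_rpow_eq_mul_sq hp (w x), mul_left_comm]
  have hp0 := hw.integrable_abs_rpow (μ := μ) hp
  have := integral_fderiv_apply_eq_zero (μ := μ) e (fun x => (hd x).differentiableAt) hi0
    (by simp only [hf]; exact (hi.const_mul p).add hp0)
  simp only [hf] at this
  rw [integral_add (hi.const_mul p) hp0, integral_const_mul] at this
  linarith

end Trace

theorem stmt10 (N : ℕ) (hN : 2 ≤ N) (p : ℝ) (hp : 2 ≤ p) (v : SchwartzMap (RN1 N) ℝ)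
    (hpde : ∀ q : RN1 N, 0 < q.2 → -lap N v q + ‖q.1‖ ^ 2 * v q = 0)
    (hbdry : ∀ x : RN N, -(fderiv ℝ (v : RN1 N → ℝ) (x, 0) (dirY N)) =
      |v (x, 0)| ^ (p - 2) * v (x, 0)) :
    ((N : ℝ) / p - ((N : ℝ) - 1) / 2) * (∫ x : RN N, |v (x, 0)| ^ p) =
      2 * ∫ q in upperHalf N, ‖q.1‖ ^ 2 * (v q) ^ 2 := by

  have hv : IsSchwartz (v : RN1 N → ℝ) := ⟨v, rfl⟩
  have hw := hv.trace
  have hdiv := setIntegral_upperHalf_divergence fun k => isSchwartz_pohozaevField hv k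
  rw [setIntegral_congr_fun (s := upperHalf N) (measurableSet_lt measurable_const measurable_snd)
    fun q hq => divergence_pohozaevField hv (hpde q hq), integral_const_mul] at hdiv
  have hQ (x : RN N) : pohozaevField N v none (x, 0) =
      -((∑ i, |v (x, 0)| ^ (p - 2) * v (x, 0) * (EuclideanSpace.proj (𝕜 := ℝ) i x *
        fderiv ℝ (fun x : RN N => v (x, 0)) x (EuclideanSpace.single i 1))) +
        ((N - 1) / 2 : ℝ) * |v (x, 0)| ^ p) := by
    rw [pohozaevField_none_boundary, abs_rpow_eq_mul_sq hp,
      show fderiv ℝ v (x, 0) (dirY N) = -(|v (x, 0)| ^ (p - 2) * v (x, 0)) by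
        rw [← hbdry, neg_neg], ← Finset.mul_sum]
    simp only [fderiv_trace hv, PiLp.proj_apply]
    ring
  have hi (i : Fin N) : Integrable (fun x : RN N => |v (x, 0)| ^ (p - 2) * v (x, 0) *
      (EuclideanSpace.proj (𝕜 := ℝ) i x *
        fderiv ℝ (fun x : RN N => v (x, 0)) x (EuclideanSpace.single i 1))) := by
    simp only [mul_assoc]
    exact hw.integrable_abs_rpow_mul (by linarith) (hw.mul ((hw.fderiv_apply _).clm_mul _))
  have hI (i : Fin N) := integral_clm_mul_fderiv_abs_rpow (μ := volume) hp hw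
    (EuclideanSpace.proj i) (EuclideanSpace.single i 1) (by simp)
  have hp0 : p ≠ 0 := by linarith
  simp only [hQ, integral_neg, neg_neg] at hdiv
  rw [integral_add (integrable_finsetSum _ fun i _ => hi i)
    ((hw.integrable_abs_rpow hp).const_mul _), integral_const_mul,
    integral_finsetSum _ fun i _ => hi i] at hdiv
  simp only [fun i => (eq_div_of_mul_eq hp0 ((mul_comm _ p).trans (hI i)))] at hdiv
  simp only [Finset.sum_const, Finset.card_univ, Fintype.card_fin, nsmul_eq_mul] at hdiv
  field_simp at hdiv ⊢
  linarith
end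
end
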